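/- arXiv:1011.1352 — 2 statements merged into one kernel-verified Lean document; each statement's English description precedes it below -/
import Mathlib

section
/- Let γ_i and γ_j be independent exponentially distributed random variables with means λ̄_i > 0 and λ̄_j > 0, and set Z = γ_i γ_j / (γ_i + 2 γ_j). Then the law of Z has density on (0,∞) given by f_Z(z) = α z e^{−β z} [ α K_0(α z) + β K_1(α z) ], where α = 2 √(2/(λ̄_i λ̄_j)) and β = 1/λ̄_j + 2/λ̄_i. -/
open MeasureTheory ProbabilityTheory

/-- The modified Bessel function of the second kind,
`K ν x = ∫_0^∞ exp (-x cosh t) cosh (ν t) dt`. -/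
noncomputable def besselK (ν x : ℝ) : ℝ :=
  ∫ t in Set.Ioi (0 : ℝ), Real.exp (-x * Real.cosh t) * Real.cosh (ν * t)

/-- The law of an exponentially distributed random variable with mean `lam > 0`:
the measure with density `x ↦ (1/lam) exp (-x/lam)` on `(0, ∞)` w.r.t. Lebesgue measure. -/
noncomputable def expLaw (lam : ℝ) : Measure ℝ :=
  MeasureTheory.volume.withDensity
    (Set.indicator (Set.Ioi (0 : ℝ))
      (fun x => ENNReal.ofReal ((1 / lam) * Real.exp (-x / lam))))

open Set in
/-- The map `y ↦ x y / (x + 2 y)` straightens the inner integral over `(0, ∞)`. -/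
theorem lintegral_Ioi_harmonic_subst {x : ℝ} (hx : 0 < x) (F : ℝ → ENNReal) :
    ∫⁻ y in Ioi (0 : ℝ), F y =
      ∫⁻ z in Ioo 0 (x / 2), ENNReal.ofReal (x ^ 2 / (x - 2 * z) ^ 2) *
        F (x * z / (x - 2 * z)) := by
  have himg : (fun z : ℝ => x * z / (x - 2 * z)) '' Ioo 0 (x / 2) = Ioi 0 := by
    ext y
    simp only [mem_image, mem_Ioo, mem_Ioi]
    constructor
    · rintro ⟨z, ⟨h0, h1⟩, rfl⟩
      have : 0 < x - 2 * z := by linarith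
      positivity
    · intro hy
      refine ⟨x * y / (x + 2 * y), ⟨by positivity, ?_⟩, ?_⟩
      · rw [div_lt_div_iff₀ (by positivity) (by norm_num)]
        nlinarith
      · have h1 : x - 2 * (x * y / (x + 2 * y)) = x ^ 2 / (x + 2 * y) := by
          field_simp
          ring
        rw [h1]
        field_simp
  have hderiv : ∀ z ∈ Ioo 0 (x / 2), HasDerivWithinAt (fun z : ℝ => x * z / (x - 2 * z))
      (x ^ 2 / (x - 2 * z) ^ 2) (Ioo 0 (x / 2)) z := by
    rintro z ⟨h0, h1⟩
    have hne : x - 2 * z ≠ 0 := by linarith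
    have h := ((hasDerivAt_id z).const_mul x).div
      (((hasDerivAt_id z).const_mul 2).const_sub x) hne
    refine (h.congr_deriv ?_).hasDerivWithinAt
    simp only [id]
    congr 1
    ring
  have hinj : InjOn (fun z : ℝ => x * z / (x - 2 * z)) (Ioo 0 (x / 2)) := by
    rintro a ⟨ha0, ha1⟩ b ⟨hb0, hb1⟩ hab
    have h1 : x - 2 * a ≠ 0 := by linarith
    have h2 : x - 2 * b ≠ 0 := by linarith
    simp only at hab
    rw [div_eq_div_iff h1 h2] at hab
    have : x ^ 2 * (a - b) = 0 := by linear_combination hab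
    have := (mul_eq_zero.1 this).resolve_left (by positivity)
    linarith
  rw [← himg, lintegral_image_eq_lintegral_abs_deriv_mul measurableSet_Ioo hderiv hinj]
  refine lintegral_congr fun z => ?_
  rw [abs_of_nonneg (by positivity)]

open Set in
/-- The substitution `x = z (2 + c eᵗ)` maps the real line onto `(2 z, ∞)`. -/
theorem lintegral_Ioi_exp_subst {z c : ℝ} (hz : 0 < z) (hc : 0 < c) (F : ℝ → ENNReal) :
    ∫⁻ x in Ioi (2 * z), F x =
      ∫⁻ t : ℝ, ENNReal.ofReal (z * (c * Real.exp t)) * F (z * (2 + c * Real.exp t)) := by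
  have himg : (fun t : ℝ => z * (2 + c * Real.exp t)) '' univ = Ioi (2 * z) := by
    ext x
    simp only [mem_image, mem_univ, true_and, mem_Ioi]
    constructor
    · rintro ⟨t, rfl⟩
      have : 0 < z * (c * Real.exp t) := by positivity
      linarith
    · intro hx
      refine ⟨Real.log ((x - 2 * z) / (z * c)), ?_⟩
      have : 0 < x - 2 * z := by linarith
      rw [Real.exp_log (by positivity)]
      field_simp
      ring
  have hderiv : ∀ t ∈ (univ : Set ℝ), HasDerivWithinAt (fun t : ℝ => z * (2 + c * Real.exp t))
      (z * (c * Real.exp t)) univ t := fun t _ =>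
    ((((Real.hasDerivAt_exp t).const_mul c).const_add 2).const_mul z).hasDerivWithinAt
  have hinj : InjOn (fun t : ℝ => z * (2 + c * Real.exp t)) univ := by
    intro a _ b _ hab
    have h := mul_left_cancel₀ hz.ne' hab
    exact Real.exp_injective (mul_left_cancel₀ hc.ne' (add_left_cancel h))
  rw [← himg, lintegral_image_eq_lintegral_abs_deriv_mul MeasurableSet.univ hderiv hinj,
    Measure.restrict_univ]
  refine lintegral_congr fun t => ?_
  rw [abs_of_nonneg (by positivity)]

open Set in
theorem lintegral_eq_lintegral_Ioi_add_neg {F : ℝ → ENNReal} (hF : Measurable F) :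
    ∫⁻ t, F t = ∫⁻ t in Ioi (0 : ℝ), (F t + F (-t)) := by
  rw [lintegral_add_left hF, ← lintegral_add_compl F (measurableSet_Ioi (a := (0 : ℝ))),
    compl_Ioi]
  congr 1
  have h := (Measure.measurePreserving_neg (volume : Measure ℝ)).setLIntegral_comp_preimage
    (measurableSet_Iic (a := (0 : ℝ))) hF
  rw [← h]
  have : (fun x : ℝ => -x) ⁻¹' Iic 0 = Ici 0 := by ext; simp
  change ∫⁻ a in (fun x : ℝ => -x) ⁻¹' Iic 0, F (-a) = _
  rw [this]
  exact (setLIntegral_congr Ioi_ae_eq_Ici).symm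

theorem integrableOn_exp_neg_mul_cosh_mul_cosh {w : ℝ} (hw : 0 < w) :
    IntegrableOn (fun t => Real.exp (-w * Real.cosh t) * Real.cosh t) (Set.Ioi 0) := by
  have hd : ∀ t : ℝ, HasDerivAt (fun t => Real.exp (-w * Real.sinh t))
      (Real.exp (-w * Real.sinh t) * (-w * Real.cosh t)) t := fun t =>
    ((Real.hasDerivAt_sinh t).const_mul (-w)).exp
  have hlim : Filter.Tendsto (fun t => Real.exp (-w * Real.sinh t)) Filter.atTop (nhds 0) := by
    refine Real.tendsto_exp_atBot.comp ?_
    refine Filter.Tendsto.const_mul_atTop_of_neg (by linarith) ?_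
    refine Filter.tendsto_atTop_mono' _ ?_ Filter.tendsto_id
    filter_upwards [Filter.eventually_ge_atTop 0] with t ht
    exact Real.self_le_sinh_iff.2 ht
  have hint := integrableOn_Ioi_deriv_of_nonpos' (a := 0) (fun t _ => hd t)
    (fun t _ => by
      have := Real.cosh_pos t
      have : 0 ≤ Real.exp (-w * Real.sinh t) * (w * Real.cosh t) := by positivity
      linarith) hlim
  refine (hint.const_mul (-(1 / w))).mono' (by fun_prop) (Filter.Eventually.of_forall fun t => ?_)
  have hc := Real.cosh_pos t
  rw [Real.norm_of_nonneg (by positivity)]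
  have h1 : -(1 / w) * (Real.exp (-w * Real.sinh t) * (-w * Real.cosh t)) =
      Real.exp (-w * Real.sinh t) * Real.cosh t := by field_simp
  rw [h1]
  gcongr ?_ * _
  refine Real.exp_le_exp.2 ?_
  nlinarith [(Real.sinh_lt_cosh t)]

theorem integrableOn_besselK_zero {w : ℝ} (hw : 0 < w) :
    IntegrableOn (fun t => Real.exp (-w * Real.cosh t) * Real.cosh (0 * t)) (Set.Ioi 0) := by
  refine (integrableOn_exp_neg_mul_cosh_mul_cosh hw).mono' (by fun_prop)
    (Filter.Eventually.of_forall fun t => ?_)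
  rw [Real.norm_of_nonneg (by have := Real.cosh_pos (0 * t); positivity)]
  gcongr
  simp

theorem integrableOn_besselK_one {w : ℝ} (hw : 0 < w) :
    IntegrableOn (fun t => Real.exp (-w * Real.cosh t) * Real.cosh (1 * t)) (Set.Ioi 0) := by
  simp only [one_mul]
  exact integrableOn_exp_neg_mul_cosh_mul_cosh hw

theorem lintegral_exp_neg_mul_cosh {w a b c : ℝ} (hw : 0 < w) (ha : 0 ≤ a) (hb : 0 ≤ b)
    (hc : 0 ≤ c) :
    ∫⁻ t : ℝ, ENNReal.ofReal (Real.exp (-w * Real.cosh t) *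
        (a + b * Real.exp (-t) + c * Real.exp t)) =
      ENNReal.ofReal (2 * a * besselK 0 w + 2 * (b + c) * besselK 1 w) := by
  have hI : IntegrableOn (fun t => 2 * a * (Real.exp (-w * Real.cosh t) * Real.cosh (0 * t)) +
      2 * (b + c) * (Real.exp (-w * Real.cosh t) * Real.cosh (1 * t))) (Set.Ioi 0) :=
    ((integrableOn_besselK_zero hw).const_mul (2 * a)).add
      ((integrableOn_besselK_one hw).const_mul (2 * (b + c)))
  rw [lintegral_eq_lintegral_Ioi_add_neg (by fun_prop), besselK, besselK,
    ← integral_const_mul, ← integral_const_mul, ← integral_add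
      ((integrableOn_besselK_zero hw).const_mul (2 * a))
      ((integrableOn_besselK_one hw).const_mul (2 * (b + c))),
    ofReal_integral_eq_lintegral_ofReal hI (Filter.Eventually.of_forall fun t => by
      have h0 := Real.cosh_pos (0 * t)
      have h1 := Real.cosh_pos (1 * t)
      positivity)]
  refine lintegral_congr fun t => ?_
  rw [← ENNReal.ofReal_add (by positivity) (by positivity)]
  congr 1
  simp only [Real.cosh_neg, neg_neg, zero_mul, Real.cosh_zero, one_mul]
  have h2 : Real.exp t + Real.exp (-t) = 2 * Real.cosh t := by
    rw [Real.cosh_eq]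
    ring
  linear_combination (b + c) * Real.exp (-w * Real.cosh t) * h2

theorem lintegral_expLaw (lam : ℝ) {F : ℝ → ENNReal} (hF : Measurable F) :
    ∫⁻ x, F x ∂(expLaw lam) = ∫⁻ x in Set.Ioi (0 : ℝ),
      ENNReal.ofReal ((1 / lam) * Real.exp (-x / lam)) * F x := by
  rw [expLaw, withDensity_indicator measurableSet_Ioi,
    lintegral_withDensity_eq_lintegral_mul _ (by fun_prop) hF]
  rfl

instance sFinite_expLaw (lam : ℝ) : SFinite (expLaw lam) := by
  unfold expLaw
  infer_instance

/-- The inner integral, over the first variable with `z` held fixed. -/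
theorem lintegral_conditional_density {li lj α β z : ℝ} (hi : 0 < li) (hj : 0 < lj)
    (hα : α = 2 * Real.sqrt (2 / (li * lj))) (hβ : β = 1 / lj + 2 / li) (hz : 0 < z) :
    ∫⁻ x in Set.Ioi (2 * z), ENNReal.ofReal ((1 / li) * Real.exp (-x / li)) *
        (ENNReal.ofReal (x ^ 2 / (x - 2 * z) ^ 2) *
          ENNReal.ofReal ((1 / lj) * Real.exp (-(x * z / (x - 2 * z)) / lj))) =
      ENNReal.ofReal (α * z * Real.exp (-β * z) *
        (α * besselK 0 (α * z) + β * besselK 1 (α * z))) := by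
  have hα0 : 0 < α := by rw [hα]; positivity
  have hα2 : α ^ 2 * (li * lj) = 8 := by
    rw [hα, mul_pow, Real.sq_sqrt (by positivity)]
    field_simp
    norm_num
  have hβlam : β * (li * lj) = li + 2 * lj := by
    rw [hβ]
    field_simp
  obtain ⟨c, hc⟩ : ∃ c, c = α * li / 2 := ⟨_, rfl⟩
  have hc0 : 0 < c := by rw [hc]; positivity
  set k : ℝ := z * Real.exp (-β * z) / (li * lj) with hk
  have hk0 : 0 < k := by positivity
  rw [lintegral_Ioi_exp_subst hz hc0]
  have key := lintegral_exp_neg_mul_cosh (w := α * z) (a := k * 4) (b := k * (α * lj))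
    (c := k * c) (by positivity) (by positivity) (by positivity) (by positivity)
  calc _ = _ := ?_
    _ = _ := key
    _ = _ := ?_
  · refine lintegral_congr fun t => ?_
    rw [← ENNReal.ofReal_mul (by positivity), ← ENNReal.ofReal_mul (by positivity),
      ← ENNReal.ofReal_mul (by positivity)]
    congr 1
    have hE : 0 < Real.exp t := Real.exp_pos t
    have hd : z * (2 + c * Real.exp t) - 2 * z = z * (c * Real.exp t) := by ring
    rw [hd]
    have hexp : Real.exp (-(z * (2 + c * Real.exp t)) / li) *
        Real.exp (-(z * (2 + c * Real.exp t) * z / (z * (c * Real.exp t))) / lj) =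
        Real.exp (-β * z) * Real.exp (-(α * z) * Real.cosh t) := by
      rw [← Real.exp_add, ← Real.exp_add]
      congr 1
      rw [Real.cosh_eq, Real.exp_neg, hβ, hc]
      field_simp
      linear_combination (1 : ℝ) * hα2
    have hrat : z * (c * Real.exp t) *
        ((z * (2 + c * Real.exp t)) ^ 2 / (z * (c * Real.exp t)) ^ 2) =
        z * (4 + α * lj * Real.exp (-t) + c * Real.exp t) := by
      rw [Real.exp_neg]
      have h4 : α * lj = 4 / c := by
        rw [hc]
        field_simp
        linarith
      rw [h4]
      field_simp
      ring
    calc _ = (1 / (li * lj)) * (z * (c * Real.exp t) *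
          ((z * (2 + c * Real.exp t)) ^ 2 / (z * (c * Real.exp t)) ^ 2)) *
          (Real.exp (-(z * (2 + c * Real.exp t)) / li) *
        Real.exp (-(z * (2 + c * Real.exp t) * z / (z * (c * Real.exp t))) / lj)) := by
          ring
      _ = _ := by
        rw [hexp, hrat, hk]
        ring
  · congr 1
    have h1 : 2 * (k * 4) = α * z * Real.exp (-β * z) * α := by
      rw [hk]
      field_simp
      linarith
    have h2 : 2 * (k * (α * lj) + k * c) = α * z * Real.exp (-β * z) * β := by
      rw [hk, hc]
      field_simp
      linarith
    rw [h1, h2]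
    ring

theorem density_of_Z
    {Ω : Type*} [MeasurableSpace Ω] (μpr : Measure Ω) [IsProbabilityMeasure μpr]
    (γi γj : Ω → ℝ) (hγi : Measurable γi) (hγj : Measurable γj)
    (lami lamj : ℝ) (hlami : 0 < lami) (hlamj : 0 < lamj)
    (hlawi : Measure.map γi μpr = expLaw lami)
    (hlawj : Measure.map γj μpr = expLaw lamj)
    (hindep : IndepFun γi γj μpr)
    (α β : ℝ)
    (hα : α = 2 * Real.sqrt (2 / (lami * lamj)))
    (hβ : β = 1 / lamj + 2 / lami) :
    Measure.map (fun ω => γi ω * γj ω / (γi ω + 2 * γj ω)) μpr =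
      MeasureTheory.volume.withDensity
        (Set.indicator (Set.Ioi (0 : ℝ))
          (fun z => ENNReal.ofReal
            (α * z * Real.exp (-β * z) *
              (α * besselK 0 (α * z) + β * besselK 1 (α * z))))) := by
  refine Measure.ext_of_lintegral _ fun g hg => ?_
  set Zf : ℝ × ℝ → ℝ := fun p => p.1 * p.2 / (p.1 + 2 * p.2) with hZf
  have hZm : Measurable Zf := by fun_prop
  have hpair := (indepFun_iff_map_prod_eq_prod_map_map hγi.aemeasurable hγj.aemeasurable).1 hindep
  rw [hlawi, hlawj] at hpair
  rw [lintegral_map hg (by fun_prop)]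
  have h1 : ∫⁻ ω, g (γi ω * γj ω / (γi ω + 2 * γj ω)) ∂μpr =
      ∫⁻ x, ∫⁻ y, g (Zf (x, y)) ∂(expLaw lamj) ∂(expLaw lami) := by
    rw [← lintegral_prod (fun p => g (Zf p)) (hg.comp hZm).aemeasurable, ← hpair,
      lintegral_map (f := fun p => g (Zf p)) (hg.comp hZm) (hγi.prodMk hγj)]
  have hinner : Measurable fun x => ∫⁻ y, g (Zf (x, y)) ∂(expLaw lamj) :=
    (hg.comp hZm).lintegral_prod_right'
  set f : ℝ → ENNReal := fun x => ENNReal.ofReal ((1 / lami) * Real.exp (-x / lami)) with hf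
  set J : ℝ → ℝ → ENNReal := fun x z => ENNReal.ofReal (x ^ 2 / (x - 2 * z) ^ 2) *
    ENNReal.ofReal ((1 / lamj) * Real.exp (-(x * z / (x - 2 * z)) / lamj)) with hJ
  have h2 : ∀ x ∈ Set.Ioi (0 : ℝ), f x * ∫⁻ y, g (Zf (x, y)) ∂(expLaw lamj) =
      ∫⁻ z in Set.Ioi (0 : ℝ), (Set.Ioi (2 * z)).indicator (fun x => f x * J x z * g z) x := by
    intro x hx
    have hx' : 0 < x := hx
    rw [lintegral_expLaw lamj (by fun_prop), lintegral_Ioi_harmonic_subst hx',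
      ← lintegral_const_mul' _ _ (by simp [hf]), ← lintegral_indicator measurableSet_Ioo,
      ← lintegral_indicator measurableSet_Ioi]
    refine lintegral_congr fun z => ?_
    by_cases hz : 0 < z
    · by_cases hzx : 2 * z < x
      · have hmem : z ∈ Set.Ioo 0 (x / 2) := ⟨hz, by linarith⟩
        have hmem' : x ∈ Set.Ioi (2 * z) := hzx
        rw [Set.indicator_of_mem hmem, Set.indicator_of_mem (Set.mem_Ioi.2 hz),
          Set.indicator_of_mem hmem']
        have hd : x - 2 * z ≠ 0 := by linarith
        have hZ : Zf (x, x * z / (x - 2 * z)) = z := by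
          have h3 : x + 2 * (x * z / (x - 2 * z)) = x ^ 2 / (x - 2 * z) := by
            field_simp
            ring
          simp only [hZf]
          rw [h3, mul_div_assoc', div_div_div_cancel_right₀ hd]
          field_simp
        rw [hZ]
        simp only [hJ, mul_assoc]
      · have hmem : z ∉ Set.Ioo 0 (x / 2) := fun h => hzx (by linarith [h.2])
        have hmem' : x ∉ Set.Ioi (2 * z) := hzx
        rw [Set.indicator_of_notMem hmem, Set.indicator_of_mem (Set.mem_Ioi.2 hz),
          Set.indicator_of_notMem hmem']
    · have hmem : z ∉ Set.Ioo 0 (x / 2) := fun h => hz h.1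
      rw [Set.indicator_of_notMem hmem, Set.indicator_of_notMem (Set.notMem_Ioi.2 (not_lt.1 hz))]
  have hset : MeasurableSet {p : ℝ × ℝ | 2 * p.2 < p.1} :=
    measurableSet_lt (by fun_prop) (by fun_prop)
  have hmeas : Measurable (Function.uncurry fun x z : ℝ =>
      (Set.Ioi (2 * z)).indicator (fun x => f x * J x z * g z) x) := by
    have hm : Measurable fun p : ℝ × ℝ => f p.1 * J p.1 p.2 * g p.2 := by
      simp only [hf, hJ]
      fun_prop
    exact hm.indicator hset
  have h3 : ∀ z ∈ Set.Ioi (0 : ℝ), ∫⁻ x in Set.Ioi (0 : ℝ),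
      (Set.Ioi (2 * z)).indicator (fun x => f x * J x z * g z) x =
      ENNReal.ofReal (α * z * Real.exp (-β * z) *
        (α * besselK 0 (α * z) + β * besselK 1 (α * z))) * g z := by
    intro z hz
    have hz' : 0 < z := hz
    rw [← lintegral_conditional_density hlami hlamj hα hβ hz',
      ← lintegral_mul_const _ (by fun_prop), setLIntegral_indicator measurableSet_Ioi,
      Set.inter_eq_left.2 (Set.Ioi_subset_Ioi (by linarith))]
  rw [h1, lintegral_expLaw lami hinner, setLIntegral_congr_fun measurableSet_Ioi h2,
    lintegral_lintegral_swap hmeas.aemeasurable, setLIntegral_congr_fun measurableSet_Ioi h3,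
    withDensity_indicator measurableSet_Ioi, lintegral_withDensity_eq_lintegral_mul₀ _
      hg.aemeasurable]
  · rfl
  · refine AEMeasurable.congr (f := fun z => ∫⁻ x in Set.Ioi (2 * z), f x * J x z) ?_ ?_
    · have hm : Measurable fun p : ℝ × ℝ => f p.1 * J p.1 p.2 := by
        simp only [hf, hJ]
        fun_prop
      refine ((hm.indicator hset).lintegral_prod_left' (μ := volume)).aemeasurable.congr
        (Filter.Eventually.of_forall fun z => ?_)
      change _ = ∫⁻ x in Set.Ioi (2 * z), f x * J x z
      rw [← lintegral_indicator measurableSet_Ioi]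
      rfl
    · filter_upwards [ae_restrict_mem measurableSet_Ioi] with z hz
      exact lintegral_conditional_density hlami hlamj hα hβ hz
end

section
/- For all real α, β with α > β > 0 and all real μ, ν with μ > ν ≥ 0, ∫_0^∞ e^{−α x} x^{μ−1} K_ν(β x) dx = √π (2β)^ν Γ(μ+ν) Γ(μ−ν) / ( (α+β)^{μ+ν} Γ(μ + 1/2) ) · ₂F₁( μ+ν, ν+1/2 ; μ+1/2 ; (α−β)/(α+β) ). -/
open MeasureTheory Real

open Set

namespace MeasureTheory

theorem integral_integral_swap_of_nonneg {X Y : Type*} [MeasurableSpace X] [MeasurableSpace Y]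
    {μ : Measure X} {ν : Measure Y} [SFinite μ] [SFinite ν] {f : X → Y → ℝ}
    (hf : AEStronglyMeasurable (Function.uncurry f) (μ.prod ν))
    (hpos : ∀ᵐ x ∂μ, ∀ᵐ y ∂ν, 0 ≤ f x y) (hpos' : ∀ᵐ y ∂ν, ∀ᵐ x ∂μ, 0 ≤ f x y)
    (hx : ∀ᵐ x ∂μ, Integrable (f x) ν) (hy : ∀ᵐ y ∂ν, Integrable (fun x ↦ f x y) μ) :
    ∫ x, ∫ y, f x y ∂ν ∂μ = ∫ y, ∫ x, f x y ∂μ ∂ν := by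
  by_cases h : Integrable (Function.uncurry f) (μ.prod ν)
  · exact integral_integral_swap h
  · have h₁ : ¬ Integrable (fun x ↦ ∫ y, f x y ∂ν) μ := fun h' ↦ h <|
      (integrable_prod_iff hf).2 ⟨hx, h'.congr <| hpos.mono fun x hx ↦
        integral_congr_ae <| hx.mono fun y hy ↦ (Real.norm_of_nonneg hy).symm⟩
    have h₂ : ¬ Integrable (fun y ↦ ∫ x, f x y ∂μ) ν := fun h' ↦ h <|
      (integrable_prod_iff' hf).2 ⟨hy, h'.congr <| hpos'.mono fun y hy ↦
        integral_congr_ae <| hy.mono fun x hx ↦ (Real.norm_of_nonneg hx).symm⟩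
    rw [integral_undef h₁, integral_undef h₂]

end MeasureTheory

theorem Real.one_add_sq_div_two_le_cosh (u : ℝ) : 1 + u ^ 2 / 2 ≤ cosh u := by
  have h : |u / 2| ≤ |sinh (u / 2)| := by
    rw [abs_sinh]
    exact self_le_sinh_iff.2 (abs_nonneg _)
  have h₁ : cosh u = cosh (u / 2) ^ 2 + sinh (u / 2) ^ 2 := by
    rw [← cosh_two_mul, mul_div_cancel₀ u two_ne_zero]
  have h₂ := cosh_sq (u / 2)
  have h₃ := sq_le_sq.2 h
  linarith [div_pow u 2 2]

theorem integrable_exp_neg_mul_cosh_add {x : ℝ} (hx : 0 < x) (c : ℝ) :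
    Integrable fun u : ℝ ↦ exp (-x * cosh u + c * u) := by
  have h := (integrable_cexp_quadratic' (b := ((-(x / 2) : ℝ) : ℂ))
    (by rw [Complex.ofReal_re]; linarith) (c : ℂ) 0).norm
  refine h.mono' (by fun_prop) (ae_of_all _ fun u ↦ ?_)
  rw [norm_of_nonneg (exp_pos _).le, Complex.norm_exp]
  norm_cast
  rw [add_zero, exp_le_exp]
  nlinarith [one_add_sq_div_two_le_cosh u]

theorem integral_exp_neg_mul_cosh_add {x : ℝ} (hx : 0 < x) (c : ℝ) :
    ∫ u : ℝ, exp (-x * cosh u + c * u) = ∫ u : ℝ, exp (-x * cosh u) * cosh (c * u) := by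
  have h : ∫ u : ℝ, exp (-x * cosh u + (-c) * u) = ∫ u : ℝ, exp (-x * cosh u + c * u) := by
    rw [← integral_neg_eq_self]
    simp
  have h' : ∫ u : ℝ, exp (-x * cosh u) * cosh (c * u) =
      ((∫ u : ℝ, exp (-x * cosh u + c * u)) + ∫ u : ℝ, exp (-x * cosh u + (-c) * u)) / 2 := by
    rw [← integral_add (integrable_exp_neg_mul_cosh_add hx c)
      (integrable_exp_neg_mul_cosh_add hx (-c)), ← integral_div]
    congr with u
    rw [cosh_eq (c * u), exp_add, exp_add, neg_mul c u]
    ring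
  rw [h', h]
  ring

theorem besselK_eq_integral_exp {x : ℝ} (hx : 0 < x) (ν : ℝ) :
    besselK ν x = (∫ u : ℝ, exp (-x * cosh u + (-ν) * u)) / 2 := by
  have h := integral_comp_abs (f := fun u ↦ exp (-x * cosh u) * cosh (ν * u))
  have h' (u : ℝ) : cosh (ν * |u|) = cosh (ν * u) := by
    rw [← cosh_abs, abs_mul, abs_abs, ← abs_mul, cosh_abs]
  simp only [cosh_abs, h'] at h
  rw [integral_exp_neg_mul_cosh_add hx, besselK]
  simp only [neg_mul ν, cosh_neg]
  linarith

theorem besselK_pos {x : ℝ} (hx : 0 < x) (ν : ℝ) : 0 < besselK ν x := by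
  rw [besselK_eq_integral_exp hx]
  exact div_pos (integral_exp_pos (integrable_exp_neg_mul_cosh_add hx _)) two_pos

theorem integral_exp_neg_mul_cosh_add_half {x : ℝ} (hx : 0 < x) :
    ∫ u : ℝ, exp (-x * cosh u + 1 / 2 * u) = √(2 * π / x) * exp (-x) := by
  rw [integral_exp_neg_mul_cosh_add hx]
  have hd (u : ℝ) : HasDerivAt (fun u ↦ sinh (1 / 2 * u)) (1 / 2 * cosh (1 / 2 * u)) u := by
    have := ((hasDerivAt_id u).const_mul (1 / 2 : ℝ)).sinh
    simpa [mul_comm] using this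
  have h := integral_image_eq_integral_abs_deriv_smul MeasurableSet.univ
    (fun u _ ↦ (hd u).hasDerivWithinAt)
    (sinh_injective.comp (mul_right_injective₀ (by norm_num))).injOn
    (fun v ↦ exp (-(2 * x) * v ^ 2))
  have hs : Function.Surjective fun u : ℝ ↦ sinh (1 / 2 * u) :=
    sinh_surjective.comp (mul_left_surjective₀ (by norm_num))
  rw [image_univ, hs.range_eq, setIntegral_univ, setIntegral_univ, integral_gaussian] at h
  have he (u : ℝ) : exp (-x * cosh u) * cosh (1 / 2 * u) =
      (2 * exp (-x)) *
        (|1 / 2 * cosh (1 / 2 * u)| • exp (-(2 * x) * sinh (1 / 2 * u) ^ 2)) := by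
    have h₁ : cosh u = cosh (1 / 2 * u) ^ 2 + sinh (1 / 2 * u) ^ 2 := by
      rw [← cosh_two_mul]
      ring_nf
    have h₂ : -x * cosh u = -x + -(2 * x) * sinh (1 / 2 * u) ^ 2 := by
      rw [h₁, cosh_sq]
      ring
    rw [abs_of_pos (by positivity), h₂, exp_add, smul_eq_mul]
    ring
  simp_rw [he]
  rw [integral_const_mul, ← h, show 2 * π / x = 2 ^ 2 * (π / (2 * x)) by field_simp,
    sqrt_mul (by positivity), sqrt_sq (by positivity)]
  ring

theorem integral_exp_half_mul_exp_neg {x t : ℝ} (hx : 0 < x) (ht : 0 < t) :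
    ∫ u : ℝ, t * exp (u / 2) * exp (-(x / 2) * (exp (-u) + t ^ 2 * exp u)) =
      √(2 * π / x) * exp (-x * t) := by
  rw [← integral_add_right_eq_self _ (-log t)]
  have he (u : ℝ) : t * exp ((u + -log t) / 2) *
        exp (-(x / 2) * (exp (-(u + -log t)) + t ^ 2 * exp (u + -log t))) =
      √t * exp (-(x * t) * cosh u + 1 / 2 * u) := by
    have h₁ : exp ((u + -log t) / 2) = exp (1 / 2 * u) / √t := by
      rw [sqrt_eq_rpow, rpow_def_of_pos ht, ← exp_sub]
      ring_nf
    have h₂ : exp (-(u + -log t)) = t * exp (-u) := by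
      rw [neg_add, neg_neg, exp_add, exp_log ht, mul_comm]
    have h₃ : exp (u + -log t) = exp u / t := by
      rw [exp_add, exp_neg, exp_log ht, div_eq_mul_inv]
    rw [h₁, h₂, h₃, exp_add, cosh_eq, mul_div_assoc', mul_comm t, mul_div_assoc, div_sqrt]
    have h₄ : -(x / 2) * (t * exp (-u) + t ^ 2 * (exp u / t)) =
      -(x * t) * ((exp u + exp (-u)) / 2) := by field_simp; ring
    rw [h₄]
    ring
  simp_rw [he]
  rw [integral_const_mul, integral_exp_neg_mul_cosh_add_half (by positivity), ← mul_assoc,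
    ← sqrt_mul ht.le, neg_mul, show t * (2 * π / (x * t)) = 2 * π / x by field_simp]

theorem integral_mul_sq_sub_one_rpow_mul_exp {ν s : ℝ} (hν : -(1 / 2) < ν) (hs : 0 < s) :
    ∫ t in Ioi (1 : ℝ), t * (t ^ 2 - 1) ^ (ν - 1 / 2) * exp (-s * t ^ 2) =
      exp (-s) * ((1 / s) ^ (ν + 1 / 2) * Gamma (ν + 1 / 2)) / 2 := by
  have hinj : InjOn (fun t : ℝ ↦ t ^ 2 - 1) (Ioi 1) := by
    intro a ha b hb hab
    simp only [mem_Ioi] at ha hb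
    exact (pow_left_inj₀ (by linarith) (by linarith) two_ne_zero).1 (by simpa using hab)
  have himg : (fun t : ℝ ↦ t ^ 2 - 1) '' Ioi 1 = Ioi 0 := by
    ext y
    simp only [mem_image, mem_Ioi]
    constructor
    · rintro ⟨t, ht, rfl⟩
      nlinarith
    · intro hy
      refine ⟨√(y + 1), ?_, ?_⟩
      · rw [lt_sqrt] <;> linarith
      · rw [sq_sqrt (by linarith)]
        ring
  have hd (t : ℝ) : HasDerivAt (fun t : ℝ ↦ t ^ 2 - 1) (2 * t) t := by
    simpa using (hasDerivAt_pow 2 t).sub_const 1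
  have h := integral_image_eq_integral_abs_deriv_smul measurableSet_Ioi
    (fun t _ ↦ (hd t).hasDerivWithinAt) hinj
    (fun y ↦ y ^ (ν + 1 / 2 - 1) * exp (-(s * y)))
  rw [himg, integral_rpow_mul_exp_neg_mul_Ioi (by linarith) hs] at h
  rw [h, mul_div_assoc, ← integral_div, ← integral_const_mul]
  refine setIntegral_congr_fun measurableSet_Ioi fun t ht ↦ ?_
  have ht : 1 < t := ht
  rw [abs_of_pos (by linarith), smul_eq_mul, show ν + 1 / 2 - 1 = ν - 1 / 2 by ring,
    show -s * t ^ 2 = -s + -(s * (t ^ 2 - 1)) by ring, exp_add]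
  ring

theorem integral_exp_neg_mul_mul_sq_sub_one_rpow {ν x : ℝ} (hν : -(1 / 2) < ν) (hx : 0 < x) :
    ∫ t in Ioi (1 : ℝ), exp (-x * t) * (t ^ 2 - 1) ^ (ν - 1 / 2) =
      Gamma (ν + 1 / 2) / √π * (x / 2) ^ (-ν) * besselK ν x := by
  let f (t u : ℝ) : ℝ := t * exp (u / 2) * exp (-(x / 2) * (exp (-u) + t ^ 2 * exp u)) *
    (t ^ 2 - 1) ^ (ν - 1 / 2)
  have hΓ : 0 < Gamma (ν + 1 / 2) := Gamma_pos_of_pos (by linarith)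
  have hf_left {t : ℝ} (ht : t ∈ Ioi (1 : ℝ)) :
      ∫ u, f t u = √(2 * π / x) * exp (-x * t) * (t ^ 2 - 1) ^ (ν - 1 / 2) := by
    have ht : 1 < t := ht
    simp only [f]
    rw [integral_mul_const, integral_exp_half_mul_exp_neg hx (by linarith)]
  have hf_right (u : ℝ) : ∫ t in Ioi (1 : ℝ), f t u =
      Gamma (ν + 1 / 2) / 2 * (x / 2) ^ (-(ν + 1 / 2)) * exp (-x * cosh u + (-ν) * u) := by
    have he (t : ℝ) : f t u = exp (u / 2) * exp (-(x / 2) * exp (-u)) *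
        (t * (t ^ 2 - 1) ^ (ν - 1 / 2) * exp (-(x / 2 * exp u) * t ^ 2)) := by
      simp only [f]
      rw [show -(x / 2) * (exp (-u) + t ^ 2 * exp u) =
        -(x / 2) * exp (-u) + -(x / 2 * exp u) * t ^ 2 by ring, exp_add]
      ring
    simp_rw [he]
    rw [integral_const_mul, integral_mul_sq_sub_one_rpow_mul_exp hν (by positivity), one_div,
      inv_rpow (by positivity), ← rpow_neg (by positivity), mul_rpow (by positivity)
      (exp_pos _).le, ← exp_mul, cosh_eq]
    have h : exp (-x * ((exp u + exp (-u)) / 2) + -ν * u) =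
        exp (u / 2) * exp (-(x / 2) * exp (-u)) * exp (-(x / 2 * exp u)) *
          exp (u * -(ν + 1 / 2)) := by
      rw [← exp_add, ← exp_add, ← exp_add]
      ring_nf
    rw [h]
    ring
  have hpos {t : ℝ} (ht : t ∈ Ioi (1 : ℝ)) (u : ℝ) : 0 ≤ f t u := by
    have ht : 1 < t := ht
    have : 0 < t ^ 2 - 1 := by nlinarith
    positivity
  have hswap := integral_integral_swap_of_nonneg (μ := volume.restrict (Ioi (1 : ℝ)))
    (ν := volume) (f := f) (by unfold f; fun_prop)
    (ae_restrict_of_forall_mem measurableSet_Ioi fun t ht ↦ ae_of_all _ (hpos ht))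
    (ae_of_all _ fun u ↦ ae_restrict_of_forall_mem measurableSet_Ioi fun t ht ↦ hpos ht u)
    (ae_restrict_of_forall_mem measurableSet_Ioi fun t ht ↦ .of_integral_ne_zero <| by
      have ht' : 1 < t := ht
      have : 0 < t ^ 2 - 1 := by nlinarith
      rw [hf_left ht]
      positivity)
    (ae_of_all _ fun u ↦ .of_integral_ne_zero <| by
      rw [hf_right u]
      positivity)
  rw [setIntegral_congr_fun measurableSet_Ioi fun t ht ↦ hf_left ht] at hswap
  simp_rw [hf_right, mul_assoc √(2 * π / x)] at hswap
  rw [integral_const_mul, integral_const_mul] at hswap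
  have hK := besselK_eq_integral_exp hx ν
  rw [eq_div_iff two_ne_zero] at hK
  rw [← hK, neg_add, rpow_add (by positivity), rpow_neg (by positivity) (1 / 2), ← sqrt_eq_rpow,
    show 2 * π / x = π / (x / 2) by field_simp, sqrt_div pi_pos.le] at hswap
  have hx' : 0 < √(x / 2) := by positivity
  have hpi : 0 < √π := by positivity
  field_simp at hswap ⊢
  linarith


theorem Real.Gamma_add_nat_eq_ascPochhammer_mul {b : ℝ} (hb : 0 < b) (n : ℕ) :
    Gamma (b + n) = (ascPochhammer ℝ n).eval b * Gamma b := by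
  induction n with
  | zero => simp
  | succ n ih =>
    rw [Nat.cast_succ, ← add_assoc, Gamma_add_one (by positivity), ih, ascPochhammer_succ_eval]
    ring

theorem Real.hasSum_ascPochhammer_mul_pow (a : ℝ) {y : ℝ} (hy : |y| < 1) :
    HasSum (fun n : ℕ ↦ (n.factorial : ℝ)⁻¹ * (ascPochhammer ℝ n).eval a * y ^ n)
      ((1 - y) ^ (-a)) := by
  have h := (one_div_one_sub_rpow_hasFPowerSeriesOnBall_zero a).hasSum (y := y)
    (by simpa [enorm_eq_nnnorm, ← NNReal.coe_lt_coe] using hy)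
  rw [zero_add, one_div, ← rpow_neg (by linarith [(abs_lt.1 hy).2])] at h
  convert! h using 2 with n
  rw [FormalMultilinearSeries.ofScalars_apply_eq, ← Ring.multichoose_eq, smul_eq_mul]
  have h' := Ring.factorial_nsmul_multichoose_eq_ascPochhammer a n
  rw [Polynomial.ascPochhammer_smeval_eq_eval, nsmul_eq_mul] at h'
  rw [← h', inv_mul_cancel_left₀ (by positivity)]

theorem Real.integral_rpow_mul_one_sub_rpow {a b : ℝ} (ha : 0 < a) (hb : 0 < b) :
    ∫ v in Ioo (0 : ℝ) 1, v ^ (a - 1) * (1 - v) ^ (b - 1) =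
      Gamma a * Gamma b / Gamma (a + b) := by
  have h := ProbabilityTheory.beta_eq_betaIntegralReal a b ha hb
  have h' : Complex.betaIntegral a b =
      ((∫ v in Ioo (0 : ℝ) 1, v ^ (a - 1) * (1 - v) ^ (b - 1) : ℝ) : ℂ) := by
    rw [Complex.betaIntegral, intervalIntegral.integral_of_le zero_le_one,
      integral_Ioc_eq_integral_Ioo, ← integral_complex_ofReal]
    refine setIntegral_congr_fun measurableSet_Ioo fun v hv ↦ ?_
    push_cast [Complex.ofReal_cpow hv.1.le, Complex.ofReal_cpow (sub_pos.2 hv.2).le]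
    rfl
  rw [h', Complex.ofReal_re] at h
  exact h.symm

theorem integral_rpow_mul_one_sub_rpow_mul_one_sub_mul_rpow {a b c z : ℝ} (hb : 0 < b)
    (hbc : b < c) (hz : |z| < 1) (ha : ∀ n : ℕ, (n : ℝ) ≠ -a) :
    ∫ v in Ioo (0 : ℝ) 1, v ^ (b - 1) * (1 - v) ^ (c - b - 1) * (1 - z * v) ^ (-a) =
      Gamma b * Gamma (c - b) / Gamma c * ordinaryHypergeometric a b c z := by
  have hc : 0 < c := hb.trans hbc
  have hΓb := Gamma_pos_of_pos hb
  have hΓc := Gamma_pos_of_pos hc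
  have hΓcb := Gamma_pos_of_pos (sub_pos.2 hbc)
  let C (n : ℕ) : ℝ := (n.factorial : ℝ)⁻¹ * (ascPochhammer ℝ n).eval a * z ^ n
  let g (n : ℕ) (v : ℝ) : ℝ := v ^ (b + n - 1) * (1 - v) ^ (c - b - 1)
  have hg (n : ℕ) : ∫ v in Ioo (0 : ℝ) 1, g n v = Gamma b * Gamma (c - b) / Gamma c *
      ((ascPochhammer ℝ n).eval b * ((ascPochhammer ℝ n).eval c)⁻¹) := by
    have := ascPochhammer_pos n c hc
    simp only [g]
    rw [integral_rpow_mul_one_sub_rpow (by positivity) (sub_pos.2 hbc),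
      show b + n + (c - b) = c + n by ring, Gamma_add_nat_eq_ascPochhammer_mul hb,
      Gamma_add_nat_eq_ascPochhammer_mul hc]
    field_simp
  have hg_pos (n : ℕ) : 0 < ∫ v in Ioo (0 : ℝ) 1, g n v := by
    have := ascPochhammer_pos n c hc
    have := ascPochhammer_pos n b hb
    rw [hg]
    positivity
  have hg_nonneg (n : ℕ) {v : ℝ} (hv : v ∈ Ioo (0 : ℝ) 1) : 0 ≤ g n v :=
    mul_nonneg (rpow_nonneg hv.1.le _) (rpow_nonneg (sub_pos.2 hv.2).le _)
  have hterm (n : ℕ) : C n * ∫ v in Ioo (0 : ℝ) 1, g n v =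
      Gamma b * Gamma (c - b) / Gamma c * ordinaryHypergeometricSeries ℝ a b c n fun _ ↦ z := by
    rw [hg, ordinaryHypergeometricSeries_apply_eq, smul_eq_mul]
    simp only [C]
    ring
  have hnorm (n : ℕ) : ∫ v in Ioo (0 : ℝ) 1, ‖C n * g n v‖ =
      Gamma b * Gamma (c - b) / Gamma c *
        ‖ordinaryHypergeometricSeries ℝ a b c n fun _ ↦ z‖ := by
    rw [← norm_of_nonneg (show 0 ≤ Gamma b * Gamma (c - b) / Gamma c by positivity), ← norm_mul,
      ← hterm, norm_mul, norm_of_nonneg (hg_pos n).le, ← integral_const_mul]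
    refine setIntegral_congr_fun measurableSet_Ioo fun v hv ↦ ?_
    rw [norm_mul, norm_of_nonneg (hg_nonneg n hv)]
  have hsum : Summable fun n ↦ ‖ordinaryHypergeometricSeries ℝ a b c n fun _ ↦ z‖ := by
    apply FormalMultilinearSeries.summable_norm_apply
    rw [ordinaryHypergeometricSeries_radius_eq_one ℝ a b c fun n ↦
      ⟨ha n, by linarith [n.cast_nonneg (α := ℝ)], by linarith [n.cast_nonneg (α := ℝ)]⟩]
    simpa [enorm_eq_nnnorm, ← NNReal.coe_lt_coe] using hz
  have hmain := (hasSum_integral_of_summable_integral_norm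
    (μ := volume.restrict (Ioo (0 : ℝ) 1)) (F := fun n v ↦ C n * g n v)
    (fun n ↦ (Integrable.of_integral_ne_zero (hg_pos n).ne').const_mul _)
    (by simpa only [hnorm] using hsum.mul_left _)).tsum_eq
  simp_rw [integral_const_mul, hterm, tsum_mul_left] at hmain
  rw [ordinaryHypergeometric, FormalMultilinearSeries.sum, hmain]
  refine setIntegral_congr_fun measurableSet_Ioo fun v hv ↦ ?_
  have hzv : |z * v| < 1 := by
    rw [abs_mul, abs_of_pos hv.1]
    nlinarith [abs_nonneg z, hv.1, hv.2]
  refine (((hasSum_ascPochhammer_mul_pow a hzv).mul_left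
    (v ^ (b - 1) * (1 - v) ^ (c - b - 1))).tsum_eq.symm.trans (tsum_congr fun n ↦ ?_))
  simp only [C, g]
  rw [show b + n - 1 = b - 1 + n by ring, rpow_add hv.1, rpow_natCast, mul_pow]
  ring

theorem integral_sq_sub_one_rpow_mul_rpow {α β μ ν : ℝ} (hβ : 0 < β) (hαβ : β < α)
    (hν : -(1 / 2) < ν) (hμν : ν < μ) (hμν' : 0 < μ + ν) :
    ∫ t in Ioi (1 : ℝ), (t ^ 2 - 1) ^ (ν - 1 / 2) * (α + β * t) ^ (-(μ + ν)) =
      4 ^ ν * (α + β) ^ (-(μ + ν)) *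
        (Gamma (ν + 1 / 2) * Gamma (μ - ν) / Gamma (μ + 1 / 2) *
          ordinaryHypergeometric (μ + ν) (ν + 1 / 2) (μ + 1 / 2) ((α - β) / (α + β))) := by
  have hz : |(α - β) / (α + β)| < 1 := by
    rw [abs_of_pos (div_pos (by linarith) (by linarith)), div_lt_one (by linarith)]
    linarith
  have hE := integral_rpow_mul_one_sub_rpow_mul_one_sub_mul_rpow (a := μ + ν) (b := ν + 1 / 2)
    (c := μ + 1 / 2) (by linarith) (by linarith) hz
    fun n ↦ by linarith [n.cast_nonneg (α := ℝ)]
  rw [show μ + 1 / 2 - (ν + 1 / 2) = μ - ν by ring] at hE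
  rw [← hE, ← integral_const_mul]
  have hd {v : ℝ} (hv : v ∈ Ioo (0 : ℝ) 1) :
      HasDerivWithinAt (fun v : ℝ ↦ (1 + v) / (1 - v)) (2 / (1 - v) ^ 2) (Ioo 0 1) v := by
    have h := ((hasDerivAt_id v).const_add 1).div ((hasDerivAt_id v).const_sub 1)
      (sub_pos.2 hv.2).ne'
    refine (h.congr_deriv ?_).hasDerivWithinAt
    simp only [id]
    ring
  have hinj : InjOn (fun v : ℝ ↦ (1 + v) / (1 - v)) (Ioo 0 1) := by
    intro v hv w hw h
    have h₁ := sub_pos.2 hv.2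
    have h₂ := sub_pos.2 hw.2
    simp only at h
    rw [div_eq_div_iff h₁.ne' h₂.ne'] at h
    linarith
  have himg : (fun v : ℝ ↦ (1 + v) / (1 - v)) '' Ioo 0 1 = Ioi 1 := by
    ext t
    simp only [mem_image, mem_Ioi]
    constructor
    · rintro ⟨v, hv, rfl⟩
      rw [one_lt_div (sub_pos.2 hv.2)]
      linarith [hv.1]
    · intro ht
      have h : 0 < t + 1 := by linarith
      refine ⟨(t - 1) / (t + 1), ⟨div_pos (by linarith) h, by rw [div_lt_one h]; linarith⟩, ?_⟩
      field_simp
      ring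
  rw [← himg, integral_image_eq_integral_abs_deriv_smul measurableSet_Ioo (fun v hv ↦ hd hv) hinj]
  refine setIntegral_congr_fun measurableSet_Ioo fun v hv ↦ ?_
  have hv₀ := hv.1
  have hv₁ := sub_pos.2 hv.2
  have hzv : 0 < 1 - (α - β) / (α + β) * v := by
    have := (abs_lt.1 hz).2
    have : (α - β) / (α + β) * v ≤ v := mul_le_of_le_one_left hv₀.le this.le
    linarith
  have hαβ' : 0 < α + β := by linarith
  have h₁ : ((1 + v) / (1 - v)) ^ 2 - 1 = 4 * v * (1 - v) ^ (-2 : ℝ) := by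
    rw [rpow_neg hv₁.le, rpow_two]
    field_simp
    ring
  have h₂ : α + β * ((1 + v) / (1 - v)) =
      (α + β) * (1 - (α - β) / (α + β) * v) * (1 - v) ^ (-1 : ℝ) := by
    rw [rpow_neg_one]
    field_simp
    ring
  have h₃ : |2 / (1 - v) ^ 2| = 4 ^ (1 / 2 : ℝ) * (1 - v) ^ (-2 : ℝ) := by
    rw [abs_of_pos (by positivity), rpow_neg hv₁.le, rpow_two, ← sqrt_eq_rpow,
      show (4 : ℝ) = 2 ^ 2 by norm_num, sqrt_sq two_pos.le]
    rfl
  have h₄ : (1 - v) ^ (μ - ν - 1) =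
      (1 - v) ^ (-2 : ℝ) * (1 - v) ^ (-2 * (ν - 1 / 2)) * (1 - v) ^ (-1 * -(μ + ν)) := by
    rw [← rpow_add hv₁, ← rpow_add hv₁]
    ring_nf
  have h₅ : (4 : ℝ) ^ ν = 4 ^ (1 / 2 : ℝ) * 4 ^ (ν - 1 / 2) := by
    rw [← rpow_add (by norm_num)]
    ring_nf
  simp only [smul_eq_mul]
  rw [h₁, h₂, h₃, h₄, h₅, mul_rpow (by positivity) (by positivity),
    mul_rpow (by positivity) (by positivity), mul_rpow (by positivity) (by positivity),
    mul_rpow (by positivity) (by positivity), ← rpow_mul hv₁.le, ← rpow_mul hv₁.le,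
    show ν + 1 / 2 - 1 = ν - 1 / 2 by ring]
  ring

theorem integral_exp_rpow_besselK (α β μ ν : ℝ) (hβ : 0 < β) (hαβ : β < α)
    (hν : 0 ≤ ν) (hμν : ν < μ) :
    ∫ x in Set.Ioi (0 : ℝ), Real.exp (-α * x) * x ^ (μ - 1) * besselK ν (β * x) =
      Real.sqrt Real.pi * (2 * β) ^ ν * Real.Gamma (μ + ν) * Real.Gamma (μ - ν) /
          ((α + β) ^ (μ + ν) * Real.Gamma (μ + 1 / 2)) *
        ordinaryHypergeometric (μ + ν) (ν + 1 / 2) (μ + 1 / 2) ((α - β) / (α + β)) := by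
  let f (x t : ℝ) : ℝ := x ^ (μ + ν - 1) * exp (-((α + β * t) * x)) * (t ^ 2 - 1) ^ (ν - 1 / 2)
  have hν' : -(1 / 2) < ν := by linarith
  have hμν' : 0 < μ + ν := by linarith
  have hΓ : 0 < Gamma (ν + 1 / 2) := Gamma_pos_of_pos (by linarith)
  have hΓ' : 0 < Gamma (μ + ν) := Gamma_pos_of_pos hμν'
  have hf_left {x : ℝ} (hx : x ∈ Ioi (0 : ℝ)) : ∫ t in Ioi (1 : ℝ), f x t =
      Gamma (ν + 1 / 2) / √π * (β / 2) ^ (-ν) *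
        (exp (-α * x) * x ^ (μ - 1) * besselK ν (β * x)) := by
    have hx : 0 < x := hx
    have he (t : ℝ) : f x t = exp (-α * x) * x ^ (μ + ν - 1) *
        (exp (-(β * x) * t) * (t ^ 2 - 1) ^ (ν - 1 / 2)) := by
      simp only [f]
      rw [show -((α + β * t) * x) = -α * x + -(β * x) * t by ring, exp_add]
      ring
    simp_rw [he]
    rw [integral_const_mul, integral_exp_neg_mul_mul_sq_sub_one_rpow hν' (by positivity),
      show β * x / 2 = β / 2 * x by ring, mul_rpow (by positivity) hx.le,
      show μ - 1 = μ + ν - 1 + -ν by ring, rpow_add hx]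
    ring
  have hf_right {t : ℝ} (ht : t ∈ Ioi (1 : ℝ)) : ∫ x in Ioi (0 : ℝ), f x t =
      Gamma (μ + ν) * ((t ^ 2 - 1) ^ (ν - 1 / 2) * (α + β * t) ^ (-(μ + ν))) := by
    have ht : 1 < t := ht
    have h : 0 < α + β * t := by nlinarith
    simp only [f]
    rw [integral_mul_const, integral_rpow_mul_exp_neg_mul_Ioi hμν' h, one_div,
      inv_rpow h.le, rpow_neg h.le]
    ring
  have hpos {x t : ℝ} (hx : x ∈ Ioi (0 : ℝ)) (ht : t ∈ Ioi (1 : ℝ)) : 0 ≤ f x t := by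
    have hx : 0 < x := hx
    have ht : 1 < t := ht
    have : 0 < t ^ 2 - 1 := by nlinarith
    positivity
  have hswap := integral_integral_swap_of_nonneg (μ := volume.restrict (Ioi (0 : ℝ)))
    (ν := volume.restrict (Ioi (1 : ℝ))) (f := f) (by unfold f; fun_prop)
    (ae_restrict_of_forall_mem measurableSet_Ioi fun x hx ↦
      ae_restrict_of_forall_mem measurableSet_Ioi fun t ht ↦ hpos hx ht)
    (ae_restrict_of_forall_mem measurableSet_Ioi fun t ht ↦
      ae_restrict_of_forall_mem measurableSet_Ioi fun x hx ↦ hpos hx ht)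
    (ae_restrict_of_forall_mem measurableSet_Ioi fun x hx ↦ .of_integral_ne_zero <| by
      have hx' : 0 < x := hx
      have := besselK_pos (mul_pos hβ hx') ν
      rw [hf_left hx]
      positivity)
    (ae_restrict_of_forall_mem measurableSet_Ioi fun t ht ↦ .of_integral_ne_zero <| by
      have ht' : 1 < t := ht
      have : 0 < t ^ 2 - 1 := by nlinarith
      have : 0 < α + β * t := by nlinarith
      rw [hf_right ht]
      positivity)
  rw [setIntegral_congr_fun measurableSet_Ioi fun x hx ↦ hf_left hx,
    setIntegral_congr_fun measurableSet_Ioi fun t ht ↦ hf_right ht, integral_const_mul,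
    integral_const_mul, integral_sq_sub_one_rpow_mul_rpow hβ hαβ hν' hμν hμν',
    rpow_neg (by positivity), rpow_neg (by linarith)] at hswap
  have h : (2 * β) ^ ν = 4 ^ ν * (β / 2) ^ ν := by
    rw [← mul_rpow (by norm_num) (by positivity)]
    ring_nf
  have hαβ' : 0 < (α + β) ^ (μ + ν) := rpow_pos_of_pos (by linarith) _
  have hΓ'' : 0 < Gamma (μ + 1 / 2) := Gamma_pos_of_pos (by linarith)
  have hβ' : 0 < (β / 2) ^ ν := by positivity
  have hpi : 0 < √π := by positivity
  rw [h]
  field_simp at hswap ⊢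
  linarith
end
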